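/- Let A be a unital simple separable stably finite C*-algebra with strict comparison of positive elements. Let a ∈ A be positive, and let q ∈ A be a projection with q ≾ a. Then there exist a projection p and a positive element b, both lying in the hereditary subalgebra her(a) = closure(aAa), such that p is Cuntz equivalent to q, pb = bp = 0, and d_τ(a) = d_τ(b) + d_τ(p) for every tracial state τ on A. -/

import Mathlib

open Filter Topology

section Defs

variable {A : Type*}

/-- Cuntz subequivalence: `a ≾ b` iff there is a sequence `vₙ` with `‖vₙ * b * vₙ* - a‖ → 0`. -/
def CuntzLE [NonUnitalCStarAlgebra A] (a b : A) : Prop :=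
  ∃ v : ℕ → A, Tendsto (fun n => ‖v n * b * star (v n) - a‖) atTop (𝓝 0)

/-- Cuntz equivalence: `a ∼ b` iff `a ≾ b` and `b ≾ a`. -/
def CuntzEquiv [NonUnitalCStarAlgebra A] (a b : A) : Prop :=
  CuntzLE a b ∧ CuntzLE b a

/-- A projection: a self-adjoint idempotent. -/
def IsProjection [Mul A] [Star A] (p : A) : Prop :=
  IsSelfAdjoint p ∧ p * p = p

/-- Murray–von Neumann equivalence of projections. -/
def MvNEquiv [Mul A] [Star A] (p q : A) : Prop :=
  ∃ v : A, star v * v = p ∧ v * star v = q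

/-- The hereditary subalgebra generated by a positive element `a`: the closure of `a A a`. -/
def her [NonUnitalCStarAlgebra A] (a : A) : Set A :=
  closure {x : A | ∃ y : A, x = a * y * a}

/-- A C*-algebra is simple if its only closed two-sided ideals are `⊥` and `⊤`. -/
def IsSimpleCStarAlgebra (A : Type*) [NonUnitalCStarAlgebra A] : Prop :=
  ∀ I : TwoSidedIdeal A, IsClosed (I : Set A) → I = ⊥ ∨ I = ⊤

/-- A unital C*-algebra is approximately divisible if for each `N ≥ 1` there is an
approximately central sequence of unital `*`-homomorphisms `M_N(ℂ) ⊕ M_{N+1}(ℂ) → A`. -/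
def ApproximatelyDivisible (A : Type*) [CStarAlgebra A] : Prop :=
  ∀ N : ℕ, 0 < N →
    ∃ φ : ℕ → (Matrix (Fin N) (Fin N) ℂ × Matrix (Fin (N + 1)) (Fin (N + 1)) ℂ) →⋆ₐ[ℂ] A,
      ∀ x c, Tendsto (fun n => ‖(φ n) x * c - c * (φ n) x‖) atTop (𝓝 (0 : ℝ))

/-- Real rank zero: every self-adjoint element is a norm limit of self-adjoint elements
with finite spectrum. -/
def RealRankZero (A : Type*) [CStarAlgebra A] : Prop :=
  ∀ a : A, IsSelfAdjoint a → ∀ ε : ℝ, 0 < ε →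
    ∃ b : A, IsSelfAdjoint b ∧ (spectrum ℂ b).Finite ∧ ‖a - b‖ < ε

/-- Stable finiteness: every isometry in every matrix algebra over `A` is a unitary. -/
def StablyFinite (A : Type*) [CStarAlgebra A] : Prop :=
  ∀ n : ℕ, ∀ v : Matrix (Fin n) (Fin n) A, star v * v = 1 → v * star v = 1

/-- A tracial state: a unital positive linear functional satisfying the trace identity. -/
def IsTracialState [CStarAlgebra A] (φ : A →ₗ[ℂ] ℂ) : Prop :=
  φ 1 = 1 ∧ (∀ x : A, ∃ r : ℝ, 0 ≤ r ∧ φ (star x * x) = (r : ℂ)) ∧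
    ∀ x y : A, φ (x * y) = φ (y * x)

/-- The dimension function associated to a tracial state:
`d_τ(a) = lim_{n → ∞} τ(a^{1/n})`. -/
noncomputable def dTau [CStarAlgebra A] (φ : A →ₗ[ℂ] ℂ) (a : A) : ℝ :=
  limUnder atTop (fun n : ℕ => (φ (cfc (fun t : ℝ => t ^ ((n : ℝ)⁻¹)) a)).re)

/-- Strict comparison of positive elements with respect to tracial states. -/
def StrictComparison (A : Type*) [CStarAlgebra A] [PartialOrder A] [StarOrderedRing A] : Prop :=
  ∀ a b : A, 0 ≤ a → 0 ≤ b →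
    (∀ φ : A →ₗ[ℂ] ℂ, IsTracialState φ → dTau φ a < dTau φ b) → CuntzLE a b

end Defs

section Helpers

variable {A : Type*} [CStarAlgebra A] [PartialOrder A] [StarOrderedRing A]

/-- The resolvent-type function `t ↦ 1 / (t² + η²)`. -/
noncomputable def auxG (η : ℝ) (t : ℝ) : ℝ := (t ^ 2 + η ^ 2)⁻¹

/-- Approximate unit `a² (a² + η²)⁻¹`. -/
noncomputable def auxE (η : ℝ) (a : A) : A := cfc (fun t : ℝ => t * auxG η t * t) a

lemma auxG_den_pos {η : ℝ} (hη : 0 < η) (t : ℝ) : 0 < t ^ 2 + η ^ 2 := by positivity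

lemma auxG_cont {η : ℝ} (hη : 0 < η) : Continuous (auxG η) := by
  unfold auxG
  exact Continuous.inv₀ (by fun_prop) (fun t => (auxG_den_pos hη t).ne')

lemma auxE_eq {η : ℝ} (hη : 0 < η) {a : A} (ha : 0 ≤ a) :
    auxE η a = a * cfc (auxG η) a * a := by
  have hg := auxG_cont hη
  have hsa : IsSelfAdjoint a := ha.isSelfAdjoint
  unfold auxE
  rw [cfc_mul (fun t : ℝ => t * auxG η t) (fun t => t) a (by fun_prop) (by fun_prop),
    cfc_mul (fun t : ℝ => t) (auxG η) a (by fun_prop) (by fun_prop), cfc_id' ℝ a]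

lemma auxE_isSelfAdjoint (η : ℝ) (a : A) : IsSelfAdjoint (auxE η a) := cfc_predicate _ _

lemma aux_one_sub {η : ℝ} (hη : 0 < η) (t : ℝ) :
    1 - t * auxG η t * t = η ^ 2 * auxG η t := by
  have := (auxG_den_pos hη t).ne'
  unfold auxG
  field_simp
  ring

lemma aux_bounds {η : ℝ} (hη : 0 < η) (t : ℝ) :
    0 ≤ t * auxG η t * t ∧ t * auxG η t * t ≤ 1 := by
  have h0 : 0 < auxG η t := inv_pos.mpr (auxG_den_pos hη t)
  have h1 := aux_one_sub hη t
  constructor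
  · have : 0 ≤ t ^ 2 * auxG η t := by positivity
    linarith [this]
  · have : 0 ≤ η ^ 2 * auxG η t := by positivity
    linarith

lemma aux_rpow_le {η : ℝ} (hη : 0 < η) {t : ℝ} (ht : 0 ≤ t) {s : ℝ} (hs : 0 < s) (hs2 : s ≤ 2) :
    t ^ s * η ^ 2 ≤ η ^ s * (t ^ 2 + η ^ 2) := by
  rcases le_total t η with h | h
  · have h1 : t ^ s ≤ η ^ s := Real.rpow_le_rpow ht h hs.le
    have h2 : 0 ≤ η ^ s := by positivity
    nlinarith [mul_le_mul_of_nonneg_right h1 (sq_nonneg η), mul_nonneg h2 (sq_nonneg t)]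
  · have ht0 : 0 < t := lt_of_lt_of_le hη h
    have h1 : η ^ (2 - s) ≤ t ^ (2 - s) := Real.rpow_le_rpow hη.le h (by linarith)
    have h2 : t ^ 2 = t ^ s * t ^ (2 - s) := by
      rw [← Real.rpow_add ht0]; norm_num
    have h3 : η ^ 2 = η ^ s * η ^ (2 - s) := by
      rw [← Real.rpow_add hη]; norm_num
    have h4 : 0 ≤ η ^ s := by positivity
    have h5 : 0 ≤ t ^ s := by positivity
    have h6 : t ^ s * η ^ 2 ≤ η ^ s * t ^ 2 := by
      rw [h2, h3]
      nlinarith [mul_le_mul_of_nonneg_left h1 (mul_nonneg h4 h5)]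
    nlinarith [mul_nonneg h4 (sq_nonneg η)]

lemma aux_e_le_rpow {η : ℝ} (hη : 0 < η) {t : ℝ} (ht : 0 ≤ t) {s : ℝ} (hs : 0 < s) (hs2 : s ≤ 2) :
    η ^ s * (t * auxG η t * t) ≤ t ^ s := by
  have hd := auxG_den_pos hη t
  have key : η ^ s * t ^ 2 ≤ t ^ s * (t ^ 2 + η ^ 2) := by
    rcases le_or_gt η t with h | h
    · have h1 : η ^ s ≤ t ^ s := Real.rpow_le_rpow hη.le h hs.le
      have h2 : 0 ≤ t ^ s := by positivity
      nlinarith [mul_le_mul_of_nonneg_right h1 (sq_nonneg t), mul_nonneg h2 (sq_nonneg η)]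
    · rcases ht.eq_or_lt with rfl | ht0
      · have : 0 ≤ (0:ℝ) ^ s := by positivity
        have : 0 ≤ (0:ℝ) ^ s * η ^ 2 := by positivity
        nlinarith
      · have := aux_rpow_le ht0 hη.le hs hs2
        nlinarith
  have : η ^ s * (t * auxG η t * t) = η ^ s * t ^ 2 / (t ^ 2 + η ^ 2) := by
    unfold auxG; field_simp
  rw [this, div_le_iff₀ hd]
  exact key

lemma aux_rpow_bound {η : ℝ} (hη : 0 < η) {t : ℝ} (ht : 0 ≤ t) {s : ℝ} (hs : 0 < s)
    (hs2 : s ≤ 2) : |(1 - t * auxG η t * t) * t ^ s| ≤ η ^ s := by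
  have hd := auxG_den_pos hη t
  have h0 : 0 < auxG η t := inv_pos.mpr hd
  rw [aux_one_sub hη, abs_of_nonneg (by positivity)]
  have : η ^ 2 * auxG η t * t ^ s = t ^ s * η ^ 2 / (t ^ 2 + η ^ 2) := by
    unfold auxG; field_simp
  rw [this, div_le_iff₀ hd]
  exact aux_rpow_le hη ht hs hs2

lemma auxE_one_sub {η : ℝ} (hη : 0 < η) {a : A} (ha : 0 ≤ a) :
    1 - auxE η a = cfc (fun t : ℝ => 1 - t * auxG η t * t) a := by
  have hg := auxG_cont hη
  have hsa : IsSelfAdjoint a := ha.isSelfAdjoint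
  rw [cfc_sub (fun _ : ℝ => (1:ℝ)) (fun t : ℝ => t * auxG η t * t) a (by fun_prop) (by fun_prop),
    cfc_const_one ℝ a, auxE]

lemma auxE_rpow {η : ℝ} (hη : 0 < η) {a : A} (ha : 0 ≤ a) {s : ℝ} (hs : 0 < s) (hs2 : s ≤ 2) :
    ‖(1 - auxE η a) * cfc (fun t : ℝ => t ^ s) a‖ ≤ η ^ s := by
  have hg := auxG_cont hη
  have hc : Continuous (fun t : ℝ => t ^ s) := Real.continuous_rpow_const hs.le
  rw [auxE_one_sub hη ha, ← cfc_mul (fun t : ℝ => 1 - t * auxG η t * t) (fun t : ℝ => t ^ s) a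
    (by fun_prop) (by fun_prop)]
  refine norm_cfc_le (by positivity) fun t ht => ?_
  exact aux_rpow_bound hη (spectrum_nonneg_of_nonneg ha ht) hs hs2

lemma auxE_self {η : ℝ} (hη : 0 < η) {a : A} (ha : 0 ≤ a) : ‖(1 - auxE η a) * a‖ ≤ η := by
  have hsa : IsSelfAdjoint a := ha.isSelfAdjoint
  have := auxE_rpow hη ha (s := 1) one_pos one_le_two
  simpa [cfc_id' ℝ a] using this

lemma auxE_nonneg {η : ℝ} (hη : 0 < η) (a : A) : 0 ≤ auxE η a :=
  cfc_nonneg fun t _ => (aux_bounds hη t).1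

lemma auxE_le_one {η : ℝ} (hη : 0 < η) (a : A) : auxE η a ≤ 1 :=
  cfc_le_one _ _ fun t _ => (aux_bounds hη t).2

lemma auxE_norm {η : ℝ} (hη : 0 < η) (a : A) : ‖auxE η a‖ ≤ 1 :=
  (CStarAlgebra.norm_le_one_iff_of_nonneg _ (auxE_nonneg hη a)).2 (auxE_le_one hη a)

lemma auxE_sub_norm {η : ℝ} (hη : 0 < η) (a : A) : ‖1 - auxE η a‖ ≤ 1 :=
  (CStarAlgebra.norm_le_one_iff_of_nonneg _ (sub_nonneg.2 (auxE_le_one hη a))).2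
    (sub_le_self _ (auxE_nonneg hη a))

lemma auxE_sq_le {η : ℝ} (hη : 0 < η) (a : A) : auxE η a * auxE η a ≤ auxE η a := by
  have hg := auxG_cont hη
  unfold auxE
  rw [← cfc_mul (fun t : ℝ => t * auxG η t * t) (fun t : ℝ => t * auxG η t * t) a
    (by fun_prop) (by fun_prop)]
  refine cfc_mono (fun t _ => ?_) (by fun_prop) (by fun_prop)
  have := aux_bounds hη t
  nlinarith

lemma auxE_le_rpow {η : ℝ} (hη : 0 < η) {a : A} (ha : 0 ≤ a) {s : ℝ} (hs : 0 < s) (hs2 : s ≤ 2) :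
    (η ^ s) • auxE η a ≤ cfc (fun t : ℝ => t ^ s) a := by
  have hg := auxG_cont hη
  have hc : Continuous (fun t : ℝ => t ^ s) := Real.continuous_rpow_const hs.le
  unfold auxE
  rw [← cfc_const_mul (η ^ s) (fun t : ℝ => t * auxG η t * t) a (by fun_prop)]
  exact cfc_mono (fun t ht => aux_e_le_rpow hη (spectrum_nonneg_of_nonneg ha ht) hs hs2)
    (by fun_prop) (by fun_prop)

/-- membership of the compressions -/
lemma auxE_conj_mem {η : ℝ} (hη : 0 < η) {a : A} (ha : 0 ≤ a) (x : A) :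
    ∃ y, auxE η a * x * auxE η a = a * y * a :=
  ⟨cfc (auxG η) a * a * x * a * cfc (auxG η) a, by rw [auxE_eq hη ha]; noncomm_ring⟩

lemma mem_her_of_le {a h : A} (ha : 0 ≤ a) (hh : 0 ≤ h) {K : ℝ} (hK : 0 ≤ K) (hle : h ≤ K • a) :
    h ∈ her a := by
  set s := CFC.sqrt h with hs
  have hs0 : 0 ≤ s := CFC.sqrt_nonneg h
  have hss : s * s = h := CFC.sqrt_mul_sqrt_self h hh
  have hbound : ∀ η : ℝ, 0 < η →
      ‖h - auxE η a * h * auxE η a‖ ≤ 2 * ‖s‖ * Real.sqrt (K * η) := by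
    intro η hη
    set e := auxE η a with he
    have hesa : IsSelfAdjoint (1 - e) := (IsSelfAdjoint.one A).sub (auxE_isSelfAdjoint η a)
    have h1 : ‖s * (1 - e)‖ ≤ Real.sqrt (K * η) := by
      apply Real.le_sqrt_of_sq_le
      have e1 : ‖s * (1 - e)‖ ^ 2 = ‖(1 - e) * h * (1 - e)‖ := by
        rw [sq, ← CStarRing.norm_star_mul_self, star_mul, hesa.star_eq,
          hs0.isSelfAdjoint.star_eq, ← hss]
        congr 1; noncomm_ring
      rw [e1]
      have h2 : (1 - e) * h * (1 - e) ≤ (1 - e) * (K • a) * (1 - e) :=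
        IsSelfAdjoint.conjugate_le_conjugate hle hesa
      have h3 : 0 ≤ (1 - e) * h * (1 - e) := hesa.conjugate_nonneg hh
      refine (CStarAlgebra.norm_le_norm_of_nonneg_of_le h3 h2).trans ?_
      rw [mul_smul_comm, smul_mul_assoc, norm_smul, Real.norm_of_nonneg hK]
      refine mul_le_mul_of_nonneg_left ?_ hK
      calc ‖(1 - e) * a * (1 - e)‖ ≤ ‖(1 - e) * a‖ * ‖1 - e‖ := norm_mul_le _ _
        _ ≤ η * 1 := mul_le_mul (auxE_self hη ha) (auxE_sub_norm hη a) (norm_nonneg _) hη.le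
        _ = η := mul_one η
    have h2 : ‖(1 - e) * s‖ ≤ Real.sqrt (K * η) := by
      rw [← norm_star, star_mul, hesa.star_eq, hs0.isSelfAdjoint.star_eq]; exact h1
    have h3 : h - e * h * e = ((1 - e) * s) * s + e * s * (s * (1 - e)) := by
      rw [← hss]; noncomm_ring
    rw [h3]
    have hr := Real.sqrt_nonneg (K * η)
    have h4 : ‖e * s‖ ≤ ‖s‖ := by
      refine (norm_mul_le _ _).trans ?_
      have := mul_le_mul_of_nonneg_right (auxE_norm hη a) (norm_nonneg s)
      simpa using this
    calc _ ≤ ‖((1 - e) * s) * s‖ + ‖e * s * (s * (1 - e))‖ := norm_add_le _ _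
      _ ≤ ‖(1 - e) * s‖ * ‖s‖ + ‖e * s‖ * ‖s * (1 - e)‖ :=
        add_le_add (norm_mul_le _ _) (norm_mul_le _ _)
      _ ≤ Real.sqrt (K * η) * ‖s‖ + ‖s‖ * Real.sqrt (K * η) := by gcongr
      _ = _ := by ring
  have hlim : Tendsto (fun η : ℝ => 2 * ‖s‖ * Real.sqrt (K * η)) (𝓝[>] 0) (𝓝 0) := by
    have : Continuous (fun η : ℝ => 2 * ‖s‖ * Real.sqrt (K * η)) := by fun_prop
    have h := (this.tendsto 0).mono_left (nhdsWithin_le_nhds (s := Set.Ioi 0))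
    simpa using h
  refine Metric.mem_closure_iff.2 fun ε hε => ?_
  obtain ⟨η, h1, h2⟩ := ((hlim.eventually_lt_const hε).and self_mem_nhdsWithin).exists
  exact ⟨_, auxE_conj_mem h2 ha h, by rw [dist_eq_norm]; exact (hbound η h2).trans_lt h1⟩

lemma rpow_mem_her {a : A} (ha : 0 ≤ a) {s : ℝ} (hs : 0 < s) (hs2 : s ≤ 2) :
    cfc (fun t : ℝ => t ^ s) a ∈ her a := by
  have hsa : IsSelfAdjoint a := ha.isSelfAdjoint
  have hc : Continuous (fun t : ℝ => t ^ s) := Real.continuous_rpow_const hs.le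
  have hlim : Tendsto (fun η : ℝ => η ^ s) (𝓝[>] 0) (𝓝 0) := by
    have h := (hc.tendsto 0).mono_left (nhdsWithin_le_nhds (s := Set.Ioi 0))
    simpa [Real.zero_rpow hs.ne'] using h
  refine Metric.mem_closure_iff.2 fun ε hε => ?_
  obtain ⟨η, h1, h2⟩ := ((hlim.eventually_lt_const hε).and self_mem_nhdsWithin).exists
  have h2 : 0 < η := h2
  refine ⟨auxE η a * cfc (fun t : ℝ => t ^ s) a, ⟨cfc (auxG η) a * cfc (fun t : ℝ => t ^ s) a, ?_⟩, ?_⟩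
  · have hcomm : Commute (cfc (fun t : ℝ => t ^ s) a) a := (Commute.refl a).cfc_real _
    rw [auxE_eq h2 ha]
    simp only [mul_assoc]
    rw [hcomm.eq]
  · rw [dist_eq_norm]
    have : cfc (fun t : ℝ => t ^ s) a - auxE η a * cfc (fun t : ℝ => t ^ s) a
        = (1 - auxE η a) * cfc (fun t : ℝ => t ^ s) a := by noncomm_ring
    rw [this]
    exact (auxE_rpow h2 ha hs hs2).trans_lt h1

lemma her_approx {a h : A} (ha : 0 ≤ a) (hh : h ∈ her a) {ε : ℝ} (hε : 0 < ε) :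
    ∃ η : ℝ, 0 < η ∧ ‖h - auxE η a * h * auxE η a‖ < ε := by
  obtain ⟨_, ⟨y, rfl⟩, hy⟩ := Metric.mem_closure_iff.1 hh (ε / 4) (by positivity)
  rw [dist_eq_norm] at hy
  set C := 2 * (‖y‖ * ‖a‖ + 1) with hC
  have hC0 : 0 < C := by positivity
  refine ⟨ε / (4 * C), by positivity, ?_⟩
  have hη : 0 < ε / (4 * C) := by positivity
  set η := ε / (4 * C) with hηd
  set e := auxE η a
  have he : IsSelfAdjoint e := auxE_isSelfAdjoint η a
  have h1 : ‖(1 - e) * a‖ ≤ η := auxE_self hη ha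
  have h2 : ‖a * (1 - e)‖ ≤ η := by
    rw [← norm_star, star_mul, ha.isSelfAdjoint.star_eq, ((IsSelfAdjoint.one A).sub he).star_eq]
    exact h1
  have hen : ‖e‖ ≤ 1 := auxE_norm hη a
  have hd : h - e * h * e = (h - a * y * a) + ((1 - e) * a * (y * a) + e * (a * y) * (a * (1 - e)))
      - e * (h - a * y * a) * e := by noncomm_ring
  have b1 : ‖(1 - e) * a * (y * a)‖ ≤ η * (‖y‖ * ‖a‖) :=
    (norm_mul_le _ _).trans (mul_le_mul h1 (norm_mul_le _ _) (norm_nonneg _) hη.le)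
  have b2 : ‖e * (a * y) * (a * (1 - e))‖ ≤ 1 * (‖a‖ * ‖y‖) * η :=
    (norm_mul_le _ _).trans (mul_le_mul ((norm_mul_le _ _).trans
      (mul_le_mul hen (norm_mul_le _ _) (norm_nonneg _) zero_le_one)) h2 (norm_nonneg _)
      (by positivity))
  have b3 : ‖e * (h - a * y * a) * e‖ ≤ 1 * (ε / 4) * 1 :=
    (norm_mul_le _ _).trans (mul_le_mul ((norm_mul_le _ _).trans
      (mul_le_mul hen hy.le (norm_nonneg _) zero_le_one)) hen (norm_nonneg _)
      (by positivity))
  have b4 : η * (2 * (‖y‖ * ‖a‖)) < ε / 2 := by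
    have : η * C = ε / 4 := by rw [hηd]; field_simp
    nlinarith
  rw [hd]
  have t1 := norm_sub_le ((h - a * y * a) + ((1 - e) * a * (y * a) + e * (a * y) * (a * (1 - e))))
    (e * (h - a * y * a) * e)
  have t2 := norm_add_le (h - a * y * a) ((1 - e) * a * (y * a) + e * (a * y) * (a * (1 - e)))
  have t3 := norm_add_le ((1 - e) * a * (y * a)) (e * (a * y) * (a * (1 - e)))
  nlinarith

/-- The hereditary subalgebra as a submodule. -/
noncomputable def herSub (a : A) : Submodule ℂ A :=
  (LinearMap.range ((LinearMap.mulRight ℂ a).comp (LinearMap.mulLeft ℂ a))).topologicalClosure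

lemma mem_herSub {a x : A} : x ∈ herSub a ↔ x ∈ her a := by
  unfold herSub her
  rw [← SetLike.mem_coe, Submodule.topologicalClosure_coe]
  have : ((LinearMap.range ((LinearMap.mulRight ℂ a).comp (LinearMap.mulLeft ℂ a)) :
      Submodule ℂ A) : Set A) = {x : A | ∃ y : A, x = a * y * a} := by
    ext z
    simp [eq_comm]
  rw [this]

lemma her_mul {a x z : A} (hx : x ∈ her a) (y : A) (hz : z ∈ her a) : x * y * z ∈ her a := by
  refine map_mem_closure₂ (f := fun x z => x * y * z) (by fun_prop) hx hz ?_
  rintro _ ⟨u, rfl⟩ _ ⟨v, rfl⟩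
  exact ⟨u * a * y * a * v, by noncomm_ring⟩

lemma her_mono {a c : A} (hc : c ∈ her a) : her c ⊆ her a := by
  refine closure_minimal ?_ isClosed_closure
  rintro _ ⟨y, rfl⟩
  exact her_mul hc y hc

lemma tr_nonneg {φ : A →ₗ[ℂ] ℂ} (hφ : IsTracialState φ) {x : A} (hx : 0 ≤ x) :
    0 ≤ (φ x).re := by
  obtain ⟨r, hr, h⟩ := hφ.2.1 (CFC.sqrt x)
  rw [(CFC.sqrt_nonneg x).isSelfAdjoint.star_eq, CFC.sqrt_mul_sqrt_self x hx] at h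
  rw [h]; simpa using hr

lemma tr_mono {φ : A →ₗ[ℂ] ℂ} (hφ : IsTracialState φ) {x y : A} (hx : x ≤ y) :
    (φ x).re ≤ (φ y).re := by
  have := tr_nonneg hφ (sub_nonneg.2 hx)
  rw [map_sub, Complex.sub_re] at this
  linarith

lemma tr_smul (φ : A →ₗ[ℂ] ℂ) (r : ℝ) (x : A) : (φ (r • x)).re = r * (φ x).re := by
  rw [LinearMap.map_smul_of_tower, Complex.smul_re, smul_eq_mul]

lemma tr_le_norm {φ : A →ₗ[ℂ] ℂ} (hφ : IsTracialState φ) {x : A} (hx : IsSelfAdjoint x) :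
    (φ x).re ≤ ‖x‖ := by
  have := tr_mono hφ hx.le_algebraMap_norm_self
  rw [Algebra.algebraMap_eq_smul_one, tr_smul, hφ.1] at this
  simpa using this

/-- Values of the functional on positive contractions of a set. -/
def trSet (φ : A →ₗ[ℂ] ℂ) (S : Set A) : Set ℝ :=
  {r | ∃ h ∈ S, 0 ≤ h ∧ h ≤ 1 ∧ r = (φ h).re}

lemma trSet_bdd {φ : A →ₗ[ℂ] ℂ} (hφ : IsTracialState φ) (S : Set A) : BddAbove (trSet φ S) := by
  refine ⟨1, ?_⟩
  rintro _ ⟨h, _, _, h1, rfl⟩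
  have := tr_mono hφ h1
  simpa [hφ.1] using this

lemma tendsto_rpow_inv {x : ℝ} (hx : 0 < x) :
    Tendsto (fun n : ℕ => x ^ ((n : ℝ)⁻¹)) atTop (𝓝 1) := by
  have h1 : Tendsto (fun n : ℕ => ((n : ℝ)⁻¹)) atTop (𝓝 0) := tendsto_inv_atTop_nhds_zero_nat
  have h2 := (Real.continuous_const_rpow hx.ne').tendsto 0
  rw [Real.rpow_zero] at h2
  exact h2.comp h1

lemma dTau_tendsto {φ : A →ₗ[ℂ] ℂ} (hφ : IsTracialState φ) {a : A} (ha : 0 ≤ a) :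
    Tendsto (fun n : ℕ => (φ (cfc (fun t : ℝ => t ^ ((n : ℝ)⁻¹)) a)).re) atTop
      (𝓝 (sSup (trSet φ (her a)))) := by
  have hne : (trSet φ (her a)).Nonempty :=
    ⟨_, 0, subset_closure ⟨0, by simp⟩, le_rfl, zero_le_one, rfl⟩
  have hb := trSet_bdd hφ (her a)
  set D := sSup (trSet φ (her a)) with hD
  set M := ‖a‖ * ‖(1 : A)‖ + 1 with hM
  have hM0 : 0 < M := by positivity
  have hup : ∀ᶠ n : ℕ in atTop,
      (φ (cfc (fun t : ℝ => t ^ ((n : ℝ)⁻¹)) a)).re ≤ M ^ ((n : ℝ)⁻¹) * D := by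
    filter_upwards [eventually_ge_atTop 1] with n hn
    have hn' : (1:ℝ) ≤ n := by exact_mod_cast hn
    have hs : 0 < (n : ℝ)⁻¹ := by positivity
    have hs2 : (n : ℝ)⁻¹ ≤ 2 := (inv_le_one_of_one_le₀ hn').trans one_le_two
    set s := (n : ℝ)⁻¹
    have hMs : 0 < M ^ s := by positivity
    have hmem : ((M ^ s)⁻¹ • cfc (fun t : ℝ => t ^ s) a) ∈ her a := by
      have := (herSub a).smul_mem (((M ^ s)⁻¹ : ℝ) : ℂ) (mem_herSub.2 (rpow_mem_her ha hs hs2))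
      rw [Complex.coe_smul] at this
      exact mem_herSub.1 this
    have hpos : 0 ≤ cfc (fun t : ℝ => t ^ s) a :=
      cfc_nonneg fun t ht => Real.rpow_nonneg (spectrum_nonneg_of_nonneg ha ht) _
    have hle : (M ^ s)⁻¹ • cfc (fun t : ℝ => t ^ s) a ≤ 1 := by
      have hc : Continuous (fun t : ℝ => t ^ s) := Real.continuous_rpow_const hs.le
      rw [← cfc_const_mul _ _ _ (by fun_prop)]
      refine cfc_le_one _ _ fun t ht => ?_
      rw [inv_mul_le_iff₀ hMs, mul_one]
      have ht0 := spectrum_nonneg_of_nonneg ha ht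
      refine Real.rpow_le_rpow ht0 ?_ hs.le
      have := spectrum.norm_le_norm_mul_of_mem ht
      rw [Real.norm_of_nonneg ht0] at this
      linarith
    have := le_csSup hb ⟨_, hmem, smul_nonneg (by positivity) hpos, hle, rfl⟩
    rw [tr_smul, inv_mul_le_iff₀ hMs] at this
    exact this
  have hlow : ∀ c < D, ∀ᶠ n : ℕ in atTop,
      c < (φ (cfc (fun t : ℝ => t ^ ((n : ℝ)⁻¹)) a)).re := by
    intro c hc
    obtain ⟨_, ⟨h, hh, h0, h1, rfl⟩, hch⟩ := exists_lt_of_lt_csSup hne hc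
    obtain ⟨η, hη, hap⟩ := her_approx ha hh (sub_pos.2 hch)
    have hes := auxE_isSelfAdjoint η a
    have i1 : (φ (h - auxE η a * h * auxE η a)).re ≤ ‖h - auxE η a * h * auxE η a‖ :=
      tr_le_norm hφ (h0.isSelfAdjoint.sub (hes.conjugate_nonneg h0).isSelfAdjoint)
    have i2 : (φ (auxE η a * h * auxE η a)).re ≤ (φ (auxE η a)).re := by
      refine tr_mono hφ ((hes.conjugate_le_conjugate h1).trans ?_)
      rw [mul_one]
      exact auxE_sq_le hη a
    rw [map_sub, Complex.sub_re] at i1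
    have i3 : c < (φ (auxE η a)).re := by linarith
    have hl : Tendsto (fun n : ℕ => η ^ ((n : ℝ)⁻¹) * (φ (auxE η a)).re) atTop
        (𝓝 (φ (auxE η a)).re) := by
      simpa using (tendsto_rpow_inv hη).mul_const ((φ (auxE η a)).re)
    filter_upwards [hl.eventually_const_lt i3, eventually_ge_atTop 1] with n hn1 hn
    have hn' : (1:ℝ) ≤ n := by exact_mod_cast hn
    have hs : 0 < (n : ℝ)⁻¹ := by positivity
    have hs2 : (n : ℝ)⁻¹ ≤ 2 := (inv_le_one_of_one_le₀ hn').trans one_le_two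
    have := tr_mono hφ (auxE_le_rpow hη ha hs hs2)
    rw [tr_smul] at this
    linarith
  have hupl : Tendsto (fun n : ℕ => M ^ ((n : ℝ)⁻¹) * D) atTop (𝓝 D) := by
    simpa using (tendsto_rpow_inv hM0).mul_const D
  refine tendsto_order.2 ⟨hlow, fun c hc => ?_⟩
  filter_upwards [hup, hupl.eventually_lt_const hc] with n h1 h2
  exact h1.trans_lt h2

lemma dTau_eq {φ : A →ₗ[ℂ] ℂ} (hφ : IsTracialState φ) {a : A} (ha : 0 ≤ a) :
    dTau φ a = sSup (trSet φ (her a)) := (dTau_tendsto hφ ha).limUnder_eq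

lemma proj_nonneg {p : A} (hp : IsProjection p) : 0 ≤ p := by
  have := star_mul_self_nonneg p
  rwa [hp.1.star_eq, hp.2] at this

lemma add_pow_orth {p x : A} (hp : IsProjection p) (h1 : p * x = 0) (h2 : x * p = 0) (n : ℕ) :
    (p + x) ^ (n + 1) = p + x ^ (n + 1) := by
  induction n with
  | zero => simp
  | succ k ih =>
    rw [pow_succ, ih, add_mul, mul_add, mul_add, hp.2, h1, pow_succ x k, mul_assoc, h2]
    simp [pow_succ, mul_assoc]

lemma rpow_add_orth {p b : A} (hp : IsProjection p) (hb : 0 ≤ b) (h1 : p * b = 0)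
    (h2 : b * p = 0) (n : ℕ) :
    cfc (fun t : ℝ => t ^ (((n + 1 : ℕ) : ℝ)⁻¹)) (p + b)
      = p + cfc (fun t : ℝ => t ^ (((n + 1 : ℕ) : ℝ)⁻¹)) b := by
  have hs : 0 < (((n + 1 : ℕ) : ℝ)⁻¹) := by positivity
  have hc : Continuous (fun t : ℝ => t ^ (((n + 1 : ℕ) : ℝ)⁻¹)) := Real.continuous_rpow_const hs.le
  have hp0 := proj_nonneg hp
  have root : ∀ c : A, 0 ≤ c → cfc (fun t : ℝ => t ^ (((n + 1 : ℕ) : ℝ)⁻¹)) (c ^ (n + 1)) = c := by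
    intro c hc0
    have hsa : IsSelfAdjoint c := hc0.isSelfAdjoint
    rw [← cfc_comp_pow (fun t : ℝ => t ^ (((n + 1 : ℕ) : ℝ)⁻¹)) (n + 1) c (by fun_prop)]
    conv_rhs => rw [← cfc_id' ℝ c]
    refine cfc_congr fun t ht => ?_
    exact Real.pow_rpow_inv_natCast (spectrum_nonneg_of_nonneg hc0 ht) (Nat.succ_ne_zero n)
  set x := cfc (fun t : ℝ => t ^ (((n + 1 : ℕ) : ℝ)⁻¹)) b with hx
  have hx0 : 0 ≤ x := cfc_nonneg fun t ht => Real.rpow_nonneg (spectrum_nonneg_of_nonneg hb ht) _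
  have hxn : x ^ (n + 1) = b := by
    have hsa : IsSelfAdjoint b := hb.isSelfAdjoint
    rw [hx, ← cfc_pow _ _ _ (by fun_prop)]
    conv_rhs => rw [← cfc_id' ℝ b]
    refine cfc_congr fun t ht => ?_
    exact Real.rpow_inv_natCast_pow (spectrum_nonneg_of_nonneg hb ht) (Nat.succ_ne_zero n)
  have hcomm : Commute x p := Commute.cfc_real (h2.trans h1.symm) _
  have hpx : p * x = 0 := by
    have hn' : (1 : ℝ) ≤ ((n + 1 : ℕ) : ℝ) := by exact_mod_cast Nat.succ_le_succ (Nat.zero_le n)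
    have hmem : x ∈ her b := rpow_mem_her hb hs ((inv_le_one_of_one_le₀ hn').trans one_le_two)
    have hcl : IsClosed {z : A | p * z = 0} := isClosed_eq (by fun_prop) (by fun_prop)
    refine closure_minimal ?_ hcl hmem
    rintro _ ⟨y, rfl⟩
    show p * (b * y * b) = 0
    rw [← mul_assoc, ← mul_assoc, h1, zero_mul, zero_mul]
  have hxp : x * p = 0 := by rw [hcomm.eq, hpx]
  have : p + b = (p + x) ^ (n + 1) := by rw [add_pow_orth hp hpx hxp, hxn]
  rw [this, root _ (add_nonneg hp0 hx0)]

lemma dTau_add_orth {φ : A →ₗ[ℂ] ℂ} (hφ : IsTracialState φ) {p b : A} (hp : IsProjection p)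
    (hb : 0 ≤ b) (h1 : p * b = 0) (h2 : b * p = 0) :
    dTau φ (p + b) = dTau φ b + dTau φ p := by
  have hp0 := proj_nonneg hp
  have t1 := dTau_tendsto hφ (add_nonneg hp0 hb)
  have t2 := dTau_tendsto hφ hb
  have t3 := dTau_tendsto hφ hp0
  rw [dTau_eq hφ (add_nonneg hp0 hb), dTau_eq hφ hb, dTau_eq hφ hp0]
  refine tendsto_nhds_unique t1 ((t2.add t3).congr' ?_)
  filter_upwards [eventually_ge_atTop 1] with n hn
  obtain ⟨m, rfl⟩ : ∃ m, n = m + 1 := ⟨n - 1, by omega⟩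
  have e1 := rpow_add_orth hp hb h1 h2 m
  have e2 := rpow_add_orth hp le_rfl (mul_zero p) (zero_mul p) m
  have e3 : cfc (fun t : ℝ => t ^ (((m + 1 : ℕ) : ℝ)⁻¹)) (0 : A) = 0 := by
    rw [cfc_apply_zero, Real.zero_rpow (by positivity), map_zero]
  rw [add_zero, e3, add_zero] at e2
  rw [e1, e2, map_add, Complex.add_re, add_comm]

lemma exists_conj_eq {a q : A} (ha : 0 ≤ a) (hq : IsProjection q) (hqa : CuntzLE q a) :
    ∃ w : A, w * a * star w = q ∧ q * w = w := by
  obtain ⟨v, hv⟩ := hqa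
  obtain ⟨n, hn⟩ := (hv.eventually_lt_const one_pos).exists
  generalize v n = v at hn
  set c := q * (v * a * star v) * q with hc
  have hqs := hq.1.star_eq
  have hqq := hq.2
  have hqn : ‖q‖ ≤ 1 := by
    have h := CStarRing.norm_star_mul_self (x := q)
    rw [hqs, hqq] at h
    nlinarith [norm_nonneg q]
  have hcq : ‖q - c‖ < 1 := by
    have : q - c = -(q * (v * a * star v - q) * q) := by
      have : q * q * q = q := by rw [hqq, hqq]
      rw [hc, mul_sub, sub_mul, this]; abel
    rw [this, norm_neg]
    calc _ ≤ ‖q‖ * ‖v * a * star v - q‖ * ‖q‖ :=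
          (norm_mul_le _ _).trans (mul_le_mul_of_nonneg_right (norm_mul_le _ _) (norm_nonneg _))
      _ ≤ 1 * ‖v * a * star v - q‖ * 1 := by gcongr
      _ < 1 := by simpa using hn
  set g := c + (1 - q) with hg
  have hunit : IsUnit g := by
    have := (Units.oneSub (q - c) hcq).isUnit
    have e : ((Units.oneSub (q - c) hcq : Aˣ) : A) = g := by
      rw [Units.val_oneSub, hg]; abel
    rwa [e] at this
  have hva : 0 ≤ v * a * star v := star_right_conjugate_nonneg ha v
  have hc0 : 0 ≤ c := hq.1.conjugate_nonneg hva
  have h1q : IsProjection (1 - q) := by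
    refine ⟨(IsSelfAdjoint.one A).sub hq.1, ?_⟩
    rw [mul_sub, sub_mul, sub_mul, hqq]; simp
  have hg0 : 0 ≤ g := add_nonneg hc0 (proj_nonneg h1q)
  have hgs : IsStrictlyPositive g := hunit.isStrictlyPositive hg0
  have hqc : q * c = c := by rw [hc, ← mul_assoc, ← mul_assoc, hqq]
  have hcq' : c * q = c := by rw [hc, mul_assoc, hqq]
  have hgq : g * q = c := by rw [hg, add_mul, sub_mul, hcq', hqq]; simp
  have hqg : q * g = c := by rw [hg, mul_add, mul_sub, hqc, hqq]; simp
  set r := g ^ (-(1 / 2) : ℝ) with hr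
  have hrr : r * g * r = 1 := CFC.conjugate_rpow_neg_one_half g
  have hrs : star r = r := (CFC.rpow_nonneg (a := g)).isSelfAdjoint.star_eq
  have hrq : r * q = q * r := by
    rw [hr, CFC.rpow_eq_cfc_real hg0]
    exact Commute.cfc_real (hgq.trans hqg.symm) _
  refine ⟨r * q * v, ?_, ?_⟩
  · rw [star_mul, star_mul, hrs, hqs]
    calc r * q * v * a * (star v * (q * r)) = r * c * r := by rw [hc]; noncomm_ring
      _ = r * g * r * q := by rw [← hgq]; simp only [mul_assoc]; rw [hrq]
      _ = q := by rw [hrr, one_mul]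
  · rw [← mul_assoc, ← mul_assoc, ← hrq, mul_assoc r, hqq]

end Helpers

/-- Lemma 3.1 of the paper. Let `A` be a unital simple separable stably
finite C*-algebra with strict comparison, `a` positive, and `q` a projection with `q ≾ a`.
Then there are a projection `p` and a positive `b`, both in `her(a)`, with `p ∼ q`,
`p b = b p = 0`, and `d_τ(a) = d_τ(b) + d_τ(p)` for every tracial state `τ`. -/
theorem split_projection_from_positive {A : Type*} [CStarAlgebra A] [PartialOrder A]
    [StarOrderedRing A] [TopologicalSpace.SeparableSpace A]
    (hsimple : IsSimpleCStarAlgebra A)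
    (hsf : StablyFinite A)
    (hsc : StrictComparison A)
    (a : A) (ha : 0 ≤ a) (q : A) (hq : IsProjection q) (hqa : CuntzLE q a) :
    ∃ p b : A, p ∈ her a ∧ b ∈ her a ∧ IsProjection p ∧ 0 ≤ b ∧
      CuntzEquiv p q ∧ p * b = 0 ∧ b * p = 0 ∧
      ∀ φ : A →ₗ[ℂ] ℂ, IsTracialState φ → dTau φ a = dTau φ b + dTau φ p := by
  obtain ⟨w, hw, hqw⟩ := exists_conj_eq ha hq hqa
  set s := CFC.sqrt a with hs
  have hs0 : 0 ≤ s := CFC.sqrt_nonneg a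
  have hsst : star s = s := hs0.isSelfAdjoint.star_eq
  have hss : s * s = a := CFC.sqrt_mul_sqrt_self a ha
  set x := w * s with hx
  have hxx : x * star x = q := by
    rw [hx, star_mul, hsst, ← hw, ← hss]; noncomm_ring
  have hqx : q * x = x := by rw [hx, ← mul_assoc, hqw]
  set p := star x * x with hp
  have hpsa : star p = p := by rw [hp, star_mul, star_star]
  have hpp : p * p = p := by
    calc p * p = star x * (x * star x * x) := by rw [hp]; noncomm_ring
      _ = p := by rw [hxx, hqx]
  have hP : IsProjection p := ⟨hpsa, hpp⟩
  have hp0 : 0 ≤ p := proj_nonneg hP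
  have hple : p ≤ ‖star w * w‖ • a := by
    have h := CStarAlgebra.star_left_conjugate_le_norm_smul (a := s) (b := star w * w)
      (IsSelfAdjoint.star_mul_self w)
    rw [hsst, hss] at h
    refine le_trans (le_of_eq ?_) h
    rw [hp, hx, star_mul, hsst]; noncomm_ring
  have hpa : p ∈ her a := mem_her_of_le ha hp0 (norm_nonneg _) hple
  have haa : a ∈ her a := mem_her_of_le ha ha zero_le_one (by rw [one_smul])
  have h1p : IsSelfAdjoint (1 - p) := (IsSelfAdjoint.one A).sub hpsa
  set b := (1 - p) * a * (1 - p) with hb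
  have hb0 : 0 ≤ b := h1p.conjugate_nonneg ha
  have hp1 : p * (1 - p) = 0 := by rw [mul_sub, hpp, mul_one, sub_self]
  have h1p' : (1 - p) * p = 0 := by rw [sub_mul, hpp, one_mul, sub_self]
  have hpb : p * b = 0 := by rw [hb, ← mul_assoc, ← mul_assoc, hp1, zero_mul, zero_mul]
  have hbp : b * p = 0 := by rw [hb, mul_assoc, h1p', mul_zero]
  have hba : b ∈ her a := by
    have e : b = a - p * 1 * a - a * 1 * p + p * a * p := by rw [hb]; noncomm_ring
    rw [e, ← mem_herSub]
    have m1 := mem_herSub.2 haa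
    have m2 := mem_herSub.2 (her_mul hpa 1 haa)
    have m3 := mem_herSub.2 (her_mul haa 1 hpa)
    have m4 := mem_herSub.2 (her_mul hpa a hpa)
    exact (herSub a).add_mem ((herSub a).sub_mem ((herSub a).sub_mem m1 m2) m3) m4
  have hc0 : 0 ≤ p + b := add_nonneg hp0 hb0
  have hca : p + b ∈ her a :=
    mem_herSub.1 ((herSub a).add_mem (mem_herSub.2 hpa) (mem_herSub.2 hba))
  have hac : a ∈ her (p + b) := by
    refine mem_her_of_le hc0 ha (K := 2 * ‖a‖ + 2) (by positivity) ?_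
    have i1 : a ≤ (2 : ℝ) • (p * a * p) + (2 : ℝ) • b := by
      have hsa : IsSelfAdjoint (p - (1 - p)) := IsSelfAdjoint.sub hpsa h1p
      have h := hsa.conjugate_nonneg ha
      have e : (2 : ℝ) • (p * a * p) + (2 : ℝ) • b - a = (p - (1 - p)) * a * (p - (1 - p)) := by
        rw [two_smul, two_smul, hb]; noncomm_ring
      rw [← e] at h
      exact sub_nonneg.1 h
    have i2 : p * a * p ≤ ‖a‖ • p := by
      have h := CStarAlgebra.star_left_conjugate_le_norm_smul (a := p) (b := a) ha.isSelfAdjoint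
      rwa [hpsa, hpp] at h
    have i3 : (2 : ℝ) • (p * a * p) ≤ (2 : ℝ) • (‖a‖ • p) :=
      smul_le_smul_of_nonneg_left i2 zero_le_two
    have i4 : 0 ≤ (2 : ℝ) • p := smul_nonneg zero_le_two hp0
    have i5 : 0 ≤ (2 * ‖a‖) • b := smul_nonneg (by positivity) hb0
    have e : (2 * ‖a‖ + 2) • (p + b) = ((2 : ℝ) • (‖a‖ • p) + (2 : ℝ) • b)
        + ((2 : ℝ) • p + (2 * ‖a‖) • b) := by
      rw [smul_smul]; module
    rw [e]
    exact (i1.trans (add_le_add_left i3 _)).trans (le_add_of_nonneg_right (add_nonneg i4 i5))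
  have hher : her a = her (p + b) := Set.Subset.antisymm (her_mono hac) (her_mono hca)
  refine ⟨p, b, hpa, hba, hP, hb0, ⟨⟨fun _ => star x, ?_⟩, ⟨fun _ => x, ?_⟩⟩, hpb, hbp, ?_⟩
  · have : star x * q * star (star x) - p = 0 := by
      rw [star_star, mul_assoc, hqx, ← hp, sub_self]
    simp only [this, norm_zero, tendsto_const_nhds]
  · have : x * p * star x - q = 0 := by
      have e : x * p * star x = (x * star x) * (x * star x) := by rw [hp]; noncomm_ring
      rw [e, hxx, hq.2, sub_self]
    simp only [this, norm_zero, tendsto_const_nhds]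
  · intro φ hφ
    rw [← dTau_add_orth hφ hP hb0 hpb hbp, dTau_eq hφ ha, dTau_eq hφ hc0, hher]
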